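/- (Existence of an optimal decomposition.) For every β ∈ ℝ^p, the infimum defining the SGLIG regularizer R(β) is attained: there exist V^{(1)},…,V^{(p)} ∈ ℝ^p with supp(V^{(i)}) ⊆ N_i for each i and ∑_{i=1}^p V^{(i)} = β such that ∑_{i=1}^p [ α τ_i ‖V^{(i)}‖₂ + (1−α) √(d_i) ‖V^{(i)}‖₁ ] = R(β). -/

import Mathlib

open scoped BigOperators

/-- Euclidean (ℓ₂) norm of a vector in ℝ^p. -/
noncomputable def l2 {p : ℕ} (v : Fin p → ℝ) : ℝ := Real.sqrt (∑ j, v j ^ 2)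

/-- ℓ₁ norm of a vector in ℝ^p. -/
noncomputable def l1 {p : ℕ} (v : Fin p → ℝ) : ℝ := ∑ j, |v j|

/-- The SGLIG regularizer
`R(β) = inf { ∑ᵢ (α τᵢ ‖V⁽ⁱ⁾‖₂ + (1−α) √dᵢ ‖V⁽ⁱ⁾‖₁) : supp V⁽ⁱ⁾ ⊆ Nᵢ, ∑ᵢ V⁽ⁱ⁾ = β }`,
where `dᵢ = |Nᵢ|`. -/
noncomputable def Rreg {p : ℕ} (N : Fin p → Finset (Fin p)) (τ : Fin p → ℝ) (α : ℝ)
    (β : Fin p → ℝ) : ℝ :=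
  sInf { r : ℝ | ∃ V : Fin p → Fin p → ℝ,
    (∀ i, ∀ j, j ∉ N i → V i j = 0) ∧ (∑ i, V i) = β ∧
    r = ∑ i, (α * τ i * l2 (V i) + (1 - α) * Real.sqrt ((N i).card) * l1 (V i)) }

theorem l2_nonneg {p : ℕ} (v : Fin p → ℝ) : 0 ≤ l2 v := Real.sqrt_nonneg _

theorem l1_nonneg {p : ℕ} (v : Fin p → ℝ) : 0 ≤ l1 v :=
  Finset.sum_nonneg fun _ _ => abs_nonneg _

theorem abs_le_l2 {p : ℕ} (v : Fin p → ℝ) (j : Fin p) : |v j| ≤ l2 v :=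
  Real.abs_le_sqrt <|
    Finset.single_le_sum (f := fun j => v j ^ 2) (fun _ _ => sq_nonneg _) (Finset.mem_univ j)

theorem abs_le_l1 {p : ℕ} (v : Fin p → ℝ) (j : Fin p) : |v j| ≤ l1 v :=
  Finset.single_le_sum (f := fun j => |v j|) (fun _ _ => abs_nonneg _) (Finset.mem_univ j)

theorem continuous_l2 {p : ℕ} : Continuous (l2 : (Fin p → ℝ) → ℝ) := by
  unfold l2
  fun_prop

theorem continuous_l1 {p : ℕ} : Continuous (l1 : (Fin p → ℝ) → ℝ) := by
  unfold l1
  fun_prop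

/-- A nonnegative combination of the group norms with positive total weight in each group
attains its minimum on every nonempty closed set. -/
theorem exists_isMinOn_sum_l2_l1 {p : ℕ} {a b : Fin p → ℝ} (ha : ∀ i, 0 ≤ a i)
    (hb : ∀ i, 0 ≤ b i) (hab : ∀ i, 0 < a i + b i) {S : Set (Fin p → Fin p → ℝ)}
    (hS : IsClosed S) (hne : S.Nonempty) :
    ∃ V ∈ S, IsMinOn (fun V => ∑ i, (a i * l2 (V i) + b i * l1 (V i))) S V := by
  set F : (Fin p → Fin p → ℝ) → ℝ := fun V => ∑ i, (a i * l2 (V i) + b i * l1 (V i)) with hF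
  obtain ⟨V₀, hV₀⟩ := hne
  have hcont : Continuous F := by
    have h2 := continuous_l2 (p := p)
    have h1 := continuous_l1 (p := p)
    fun_prop
  have hbound : ∀ V i j, (a i + b i) * |V i j| ≤ F V := fun V i j =>
    calc (a i + b i) * |V i j| = a i * |V i j| + b i * |V i j| := add_mul _ _ _
      _ ≤ a i * l2 (V i) + b i * l1 (V i) :=
        add_le_add (mul_le_mul_of_nonneg_left (abs_le_l2 _ _) (ha i))
          (mul_le_mul_of_nonneg_left (abs_le_l1 _ _) (hb i))
      _ ≤ F V := Finset.single_le_sum (f := fun i => a i * l2 (V i) + b i * l1 (V i))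
          (fun i _ => add_nonneg (mul_nonneg (ha i) (l2_nonneg _))
            (mul_nonneg (hb i) (l1_nonneg _))) (Finset.mem_univ i)
  have hK : IsCompact (Set.univ.pi fun i : Fin p => Set.univ.pi fun _ : Fin p =>
      Set.Icc (-(F V₀ / (a i + b i))) (F V₀ / (a i + b i))) :=
    isCompact_univ_pi fun _ => isCompact_univ_pi fun _ => isCompact_Icc
  refine hcont.continuousOn.exists_isMinOn' hS hV₀ (Filter.mem_inf_of_left ?_)
  filter_upwards [hK.compl_mem_cocompact] with V hV
  by_contra! hlt
  refine hV fun i _ j _ => abs_le.mp ?_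
  rw [le_div_iff₀' (hab i)]
  exact (hbound V i j).trans hlt.le

/-- existence of an optimal decomposition: for every `β` the infimum
defining the SGLIG regularizer is attained by some decomposition
`β = ∑ᵢ V⁽ⁱ⁾` with `supp V⁽ⁱ⁾ ⊆ Nᵢ`. -/
theorem stmt5 {p : ℕ} (N : Fin p → Finset (Fin p)) (hN : ∀ i, i ∈ N i)
    (τ : Fin p → ℝ) (hτ : ∀ i, 0 < τ i)
    (α : ℝ) (hα : 0 ≤ α ∧ α ≤ 1) (β : Fin p → ℝ) :
    ∃ V : Fin p → Fin p → ℝ,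
      (∀ i, ∀ j, j ∉ N i → V i j = 0) ∧ (∑ i, V i) = β ∧
      (∑ i, (α * τ i * l2 (V i) + (1 - α) * Real.sqrt ((N i).card) * l1 (V i)))
        = Rreg N τ α β := by
  have ha : ∀ i, 0 ≤ α * τ i := fun i => mul_nonneg hα.1 (hτ i).le
  have hd : ∀ i, 0 < Real.sqrt ((N i).card) := fun i =>
    Real.sqrt_pos.mpr (Nat.cast_pos.mpr (Finset.card_pos.mpr ⟨i, hN i⟩))
  have hb : ∀ i, 0 ≤ (1 - α) * Real.sqrt ((N i).card) := fun i =>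
    mul_nonneg (sub_nonneg.mpr hα.2) (hd i).le
  have hab : ∀ i, 0 < α * τ i + (1 - α) * Real.sqrt ((N i).card) := by
    intro i
    rcases hα.1.eq_or_lt with h | h
    · simpa [← h] using ⟨i, hN i⟩
    · exact add_pos_of_pos_of_nonneg (mul_pos h (hτ i)) (hb i)
  have hclosed : IsClosed {V : Fin p → Fin p → ℝ |
      (∀ i, ∀ j, j ∉ N i → V i j = 0) ∧ (∑ i, V i) = β} := by
    simp only [Set.ofPred_and, Set.ofPred_forall]
    refine IsClosed.inter ?_ (isClosed_eq (by fun_prop) continuous_const)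
    exact isClosed_iInter fun i => isClosed_iInter fun j => isClosed_iInter fun _ =>
      isClosed_eq (by fun_prop) continuous_const
  have hne : {V : Fin p → Fin p → ℝ |
      (∀ i, ∀ j, j ∉ N i → V i j = 0) ∧ (∑ i, V i) = β}.Nonempty :=
    ⟨fun i => Pi.single i (β i),
      fun i j hj => Pi.single_eq_of_ne (ne_of_mem_of_not_mem (hN i) hj).symm _,
      Finset.univ_sum_single β⟩
  obtain ⟨V, ⟨hsupp, hsum⟩, hmin⟩ := exists_isMinOn_sum_l2_l1 ha hb hab hclosed hne
  refine ⟨V, hsupp, hsum, Eq.symm (IsLeast.csInf_eq ?_)⟩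
  refine ⟨⟨V, hsupp, hsum, rfl⟩, ?_⟩
  rintro _ ⟨W, hWsupp, hWsum, rfl⟩
  exact hmin ⟨hWsupp, hWsum⟩
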